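/- arXiv:0711.1734 — 4 statements merged into one kernel-verified Lean document; each statement's English description precedes it below -/
import Mathlib

section
/- Let T = ⟨A_1, …, A_m⟩ be a semiorthogonal decomposition of a triangulated category T and let X be an object of T. Then the chain of morphisms 0 = X_m → X_{m−1} → … → X_1 → X_0 = X with Cone(X_k → X_{k−1}) ∈ A_k is unique and functorial: for any morphism g : X → X' and any such chains for X and for X', there exists a unique collection of morphisms X_k → X'_k and A_k → A'_k (where A_k = Cone(X_k → X_{k−1}) and A'_k = Cone(X'_k → X'_{k−1})) which, together with g, commute with all the morphisms and distinguished triangles of the two chains. -/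
/-!
STATEMENT 1:
Let `T = ⟨A_1, …, A_m⟩` be a semiorthogonal decomposition of a triangulated category `T` and
let `X` be an object of `T`. Then the chain of morphisms `0 = X_m → X_{m−1} → … → X_1 → X_0 = X`
with `Cone(X_k → X_{k−1}) ∈ A_k` is unique and functorial: for any morphism `g : X → X'` and
any such chains for `X` and for `X'`, there exists a unique collection of morphisms
`X_k → X'_k` and `A_k → A'_k` (where `A_k = Cone(X_k → X_{k−1})`) which, together with `g`,
commute with all the morphisms and distinguished triangles of the two chains.
-/

open CategoryTheory CategoryTheory.Limits CategoryTheory.Pretriangulated ZeroObject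

universe v u

variable {C : Type u} [Category.{v} C] [Preadditive C] [HasZeroObject C]
  [HasShift C ℤ] [∀ n : ℤ, (shiftFunctor C n).Additive] [Pretriangulated C]

/-- A strictly full triangulated subcategory: contains a zero object, closed under
isomorphisms, shifts and extensions. -/
structure IsTriangulatedSub (S : Set C) : Prop where
  zero_mem : (0 : C) ∈ S
  iso_closed : ∀ {X Y : C}, (X ≅ Y) → X ∈ S → Y ∈ S
  shift_mem : ∀ X ∈ S, ∀ n : ℤ, X⟦n⟧ ∈ S
  ext₂ : ∀ (T : Triangle C), (T ∈ distTriang C) → T.obj₁ ∈ S → T.obj₃ ∈ S → T.obj₂ ∈ S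

/-- A chain `0 = X_m → X_{m-1} → … → X_1 → X_0 = X` together with the distinguished triangles
`X_{k+1} → X_k → A_{k+1} → X_{k+1}[1]` exhibiting the cones `A_{k+1} ∈ A k` (0-indexed). -/
structure Filtration (m : ℕ) (A : Fin m → Set C) (X : C) where
  obj : Fin (m + 1) → C
  map : ∀ k : Fin m, obj k.succ ⟶ obj k.castSucc
  isZero_last : IsZero (obj (Fin.last m))
  obj_zero : obj 0 = X
  cone : Fin m → C
  cone_mem : ∀ k, cone k ∈ A k
  g : ∀ k : Fin m, obj k.castSucc ⟶ cone k
  h : ∀ k : Fin m, cone k ⟶ (obj k.succ)⟦(1 : ℤ)⟧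
  distinguished : ∀ k : Fin m, (Triangle.mk (map k) (g k) (h k) ∈ distTriang C)

/-- A semiorthogonal decomposition `T = ⟨A 0, …, A (m-1)⟩`: a sequence of strictly full
triangulated subcategories, semiorthogonal to each other, such that every object admits
a filtration with factors in the `A i`. -/
structure IsSOD (m : ℕ) (A : Fin m → Set C) : Prop where
  sub : ∀ i, IsTriangulatedSub (A i)
  semiorth : ∀ i j : Fin m, i < j → ∀ X ∈ A i, ∀ Y ∈ A j, ∀ k : ℤ, ∀ f : Y⟦k⟧ ⟶ X, f = 0
  filtration : ∀ X : C, Nonempty (Filtration m A X)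

section DistinguishedTriangles

variable {T T' : Triangle C}

/-- A morphism between the middle vertices of two distinguished triangles extends to a morphism of
triangles as soon as there are no nonzero morphisms from the first vertex to the third one. -/
lemma exists_triangle_morphism_of_hom₁₃_eq_zero (hT : T ∈ distTriang C) (hT' : T' ∈ distTriang C)
    (h₀ : ∀ f : T.obj₁ ⟶ T'.obj₃, f = 0) (b : T.obj₂ ⟶ T'.obj₂) :
    ∃ (a : T.obj₁ ⟶ T'.obj₁) (c : T.obj₃ ⟶ T'.obj₃), T.mor₁ ≫ b = a ≫ T'.mor₁ ∧
      T.mor₂ ≫ c = b ≫ T'.mor₂ ∧ T.mor₃ ≫ a⟦(1 : ℤ)⟧' = c ≫ T'.mor₃ := by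
  obtain ⟨a, ha⟩ := Triangle.coyoneda_exact₂ T' hT' (T.mor₁ ≫ b) (h₀ _)
  obtain ⟨c, hc, hc'⟩ := complete_distinguished_triangle_morphism T T' hT hT' a b ha
  exact ⟨a, c, ha, hc, hc'⟩

lemma eq_of_comp_mor₁_eq (hT' : T' ∈ distTriang C) {X : C}
    (h₁ : ∀ f : X⟦(1 : ℤ)⟧ ⟶ T'.obj₃, f = 0) {a a' : X ⟶ T'.obj₁}
    (h : a ≫ T'.mor₁ = a' ≫ T'.mor₁) : a = a' := by
  obtain ⟨f, hf⟩ := Triangle.coyoneda_exact₁ T' hT' ((a - a')⟦(1 : ℤ)⟧') (by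
    rw [← Functor.map_comp, Preadditive.sub_comp, h, sub_self, Functor.map_zero])
  rw [h₁ f, zero_comp] at hf
  exact sub_eq_zero.1 ((shiftFunctor C (1 : ℤ)).map_injective (by rw [hf, Functor.map_zero]))

lemma eq_of_mor₂_comp_eq (hT : T ∈ distTriang C) {Y : C}
    (h₁ : ∀ f : T.obj₁⟦(1 : ℤ)⟧ ⟶ Y, f = 0) {c c' : T.obj₃ ⟶ Y}
    (h : T.mor₂ ≫ c = T.mor₂ ≫ c') : c = c' := by
  obtain ⟨f, hf⟩ := Triangle.yoneda_exact₃ T hT (c - c') (by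
    rw [Preadditive.comp_sub, h, sub_self])
  rw [h₁ f, comp_zero] at hf
  exact sub_eq_zero.1 hf

end DistinguishedTriangles

namespace Filtration

variable {m : ℕ} {A : Fin m → Set C} {X : C}

/-- The `j`-th step of a filtration is left orthogonal, together with all its shifts, to the
components of index less than `j`. -/
lemma hom_shift_obj_eq_zero (hA : IsSOD m A) (F : Filtration m A X) (k : Fin m) {Y : C}
    (hY : Y ∈ A k) (n : ℤ) (j : Fin (m + 1)) (hkj : k.castSucc < j)
    (f : (F.obj j)⟦n⟧ ⟶ Y) : f = 0 := by
  induction j using Fin.reverseInduction with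
  | last => exact ((shiftFunctor C n).map_isZero F.isZero_last).eq_of_src _ _
  | cast j ih =>
    have hT := Triangle.shift_distinguished _ (F.distinguished j) n
    obtain ⟨f', hf'⟩ := Triangle.yoneda_exact₂ _ hT f
      (ih (hkj.trans (Fin.castSucc_lt_succ)) _)
    have hzero : f' = 0 :=
      hA.semiorth k j (Fin.castSucc_lt_castSucc_iff.1 hkj) Y hY _ (F.cone_mem j) n f'
    rw [hf', hzero]
    exact comp_zero

lemma hom_obj_succ_eq_zero (hA : IsSOD m A) (F : Filtration m A X) (k : Fin m) {Y : C}
    (hY : Y ∈ A k) (f : F.obj k.succ ⟶ Y) : f = 0 := by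
  rw [← cancel_epi ((shiftFunctorZero C ℤ).hom.app (F.obj k.succ)), comp_zero]
  exact F.hom_shift_obj_eq_zero hA k hY 0 _ Fin.castSucc_lt_succ _

end Filtration

theorem filtration_unique_functorial (m : ℕ) (A : Fin m → Set C) (hSOD : IsSOD m A)
    {X X' : C} (g : X ⟶ X') (F : Filtration m A X) (F' : Filtration m A X') :
    ∃! p : (∀ k : Fin (m + 1), F.obj k ⟶ F'.obj k) × (∀ k : Fin m, F.cone k ⟶ F'.cone k),
      (p.1 0 = eqToHom F.obj_zero ≫ g ≫ eqToHom F'.obj_zero.symm) ∧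
      (∀ k : Fin m, F.map k ≫ p.1 k.castSucc = p.1 k.succ ≫ F'.map k) ∧
      (∀ k : Fin m, F.g k ≫ p.2 k = p.1 k.castSucc ≫ F'.g k) ∧
      (∀ k : Fin m, F.h k ≫ (p.1 k.succ)⟦(1 : ℤ)⟧' = p.2 k ≫ F'.h k) := by
  have h₁ : ∀ (k : Fin m) (f : (F.obj k.succ)⟦(1 : ℤ)⟧ ⟶ F'.cone k), f = 0 := fun k f =>
    F.hom_shift_obj_eq_zero hSOD k (F'.cone_mem k) 1 _ Fin.castSucc_lt_succ f
  have hstep : ∀ (k : Fin m) (b : F.obj k.castSucc ⟶ F'.obj k.castSucc),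
      ∃ (a : F.obj k.succ ⟶ F'.obj k.succ) (c : F.cone k ⟶ F'.cone k),
        F.map k ≫ b = a ≫ F'.map k ∧ F.g k ≫ c = b ≫ F'.g k ∧
          F.h k ≫ a⟦(1 : ℤ)⟧' = c ≫ F'.h k := fun k b =>
    exists_triangle_morphism_of_hom₁₃_eq_zero (F.distinguished k) (F'.distinguished k)
      (F.hom_obj_succ_eq_zero hSOD k (F'.cone_mem k)) b
  choose a c hmap hg hh using hstep
  let φ : ∀ k : Fin (m + 1), F.obj k ⟶ F'.obj k :=
    Fin.induction (eqToHom F.obj_zero ≫ g ≫ eqToHom F'.obj_zero.symm) a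
  have hφ : ∀ k : Fin m, φ k.succ = a k (φ k.castSucc) := fun k => Fin.induction_succ _ _ k
  refine ⟨⟨φ, fun k => c k (φ k.castSucc)⟩, ⟨rfl, fun k => ?_, fun k => hg k _, fun k => ?_⟩, ?_⟩
  · dsimp only
    rw [hφ, hmap]
  · dsimp only
    rw [hφ, hh]
  · rintro ⟨ψ, d⟩ ⟨hψ₀, hψ, hd, -⟩
    dsimp only at hψ₀ hψ hd
    have hψφ : ψ = φ := by
      funext k
      induction k using Fin.induction with
      | zero => exact hψ₀
      | succ k ih =>
        refine eq_of_comp_mor₁_eq (F'.distinguished k) (h₁ k) ?_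
        exact (hψ k).symm.trans (by rw [ih, hmap, hφ]; rfl)
    subst hψφ
    refine Prod.ext rfl (funext fun k => ?_)
    exact eq_of_mor₂_comp_eq (F.distinguished k) (h₁ k) ((hd k).trans (hg k _).symm)
end

section
/- Let A be an abelian category with countable coproducts in which colimits of sequences exist and are exact. Let F_1 → F_2 → F_3 → … be a sequence in the unbounded derived category D(A) together with a morphism of the direct system to an object F which approximates F, i.e. for every n ≥ 0 there exists K such that the induced morphism τ^{≤n}τ^{≥−n}F_k → τ^{≤n}τ^{≥−n}F is an isomorphism for all k ≥ K. Then hocolim F_i ≅ F. -/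
/-!
STATEMENT 12:
Let `A` be an abelian category with countable coproducts in which colimits of sequences exist
and are exact. Let `F₁ → F₂ → …` be a sequence in `D(A)` together with a morphism of the
direct system to an object `Y` which approximates `Y`: for every `n ≥ 0` there exists `K`
such that the induced morphism `τ^{≤n}τ^{≥−n}F_k → τ^{≤n}τ^{≥−n}Y` is an isomorphism for all
`k ≥ K` (equivalently, the maps `H^t(F_k) → H^t(Y)` are isomorphisms for all `−n ≤ t ≤ n` and
all `k ≥ K`). Then `hocolim Fᵢ ≅ Y`.
-/

open CategoryTheory CategoryTheory.Limits CategoryTheory.Pretriangulated ZeroObject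
  DerivedCategory

universe w v u

variable {A : Type u} [Category.{v} A] [Abelian A]
  [HasCountableCoproducts A] [HasColimitsOfShape ℕ A]
  [PreservesFiniteLimits (colim : (ℕ ⥤ A) ⥤ A)]
  [HasDerivedCategory.{w} A]

/-- `L` is a homotopy colimit in `D(A)` of a sequence of cochain complexes `F` with
transition morphisms `f n : Q(F n) ⟶ Q(F (n+1))` in `D(A)`: the morphism `id − shift` on
`Q(⊕ᵢ Fᵢ)` (where `shift` is characterized by its compatibility with the coproduct
injections) can be completed to a distinguished triangle whose third object is `L`. -/
noncomputable def IsHocolimQ (F : ℕ → CochainComplex A ℤ)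
    (f : ∀ n, (Q.obj (F n) : DerivedCategory A) ⟶ Q.obj (F (n + 1)))
    (L : DerivedCategory A) : Prop :=
  ∃ σ : Q.obj (∐ F) ⟶ Q.obj (∐ F),
    (∀ n, Q.map (Sigma.ι F n) ≫ σ = f n ≫ Q.map (Sigma.ι F (n + 1))) ∧
    ∃ (g : Q.obj (∐ F) ⟶ L) (h : L ⟶ (Q.obj (∐ F))⟦(1 : ℤ)⟧),
      (Triangle.mk (𝟙 (Q.obj (∐ F)) - σ) g h ∈ distTriang (DerivedCategory A))

/-- A morphism of a direct system `(F, f)` to `Y` approximates `Y` if for every `n ≥ 0` there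
exists `K` such that `τ^{≤n}τ^{≥−n}F_k → τ^{≤n}τ^{≥−n}Y` is an isomorphism for all `k ≥ K`;
equivalently, `H^t(F_k) → H^t(Y)` is an isomorphism for all `t` with `−n ≤ t ≤ n`. -/
def Approximates (F : ℕ → CochainComplex A ℤ)
    (Y : DerivedCategory A) (e : ∀ n, (Q.obj (F n) : DerivedCategory A) ⟶ Y) : Prop :=
  ∀ n : ℕ, ∃ K : ℕ, ∀ k ≥ K, ∀ t : ℤ, -(n : ℤ) ≤ t → t ≤ (n : ℤ) →
    IsIso ((homologyFunctor A t).map (e k))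

section Homology

variable {C : Type*} [Category* C] [Abelian C] {J : Type} [HasColimitsOfShape (Discrete J) C]
  [HasExactColimitsOfShape (Discrete J) C]

theorem countableAB4_of_exact_sequential_colimits [HasCountableCoproducts C]
    [HasColimitsOfShape ℕ C] [PreservesFiniteLimits (colim : (ℕ ⥤ C) ⥤ C)] : CountableAB4 C :=
  have : HasFiniteBiproducts C := Abelian.hasFiniteBiproducts
  have : HasExactColimitsOfShape ℕ C := ⟨inferInstance⟩
  CountableAB4.of_countableAB5 C

/-- If coproducts indexed by `J` are exact, the homology of a coproduct of short complexes is the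
coproduct of the homologies. -/
theorem nonempty_isColimit_cofan_homologyMap (S : J → ShortComplex C) (T : ShortComplex C)
    (j : ∀ n, S n ⟶ T)
    (h₁ : IsColimit (Cofan.mk T.X₁ fun n ↦ (j n).τ₁))
    (h₂ : IsColimit (Cofan.mk T.X₂ fun n ↦ (j n).τ₂))
    (h₃ : IsColimit (Cofan.mk T.X₃ fun n ↦ (j n).τ₃)) :
    Nonempty (IsColimit (Cofan.mk T.homology fun n ↦ ShortComplex.homologyMap (j n))) := by
  let S' : ShortComplex (Discrete J ⥤ C) :=
    { X₁ := Discrete.functor fun n ↦ (S n).X₁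
      X₂ := Discrete.functor fun n ↦ (S n).X₂
      X₃ := Discrete.functor fun n ↦ (S n).X₃
      f := Discrete.natTrans fun n ↦ (S n.as).f
      g := Discrete.natTrans fun n ↦ (S n.as).g
      zero := by ext n; exact (S n.as).zero }
  let e₁ := (colimit.isColimit S'.X₁).coconePointUniqueUpToIso h₁
  have w₁ (n : J) : colimit.ι S'.X₁ ⟨n⟩ ≫ e₁.hom = (j n).τ₁ :=
    colimit.comp_coconePointUniqueUpToIso_hom h₁ ⟨n⟩
  let e₂ := (colimit.isColimit S'.X₂).coconePointUniqueUpToIso h₂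
  have w₂ (n : J) : colimit.ι S'.X₂ ⟨n⟩ ≫ e₂.hom = (j n).τ₂ :=
    colimit.comp_coconePointUniqueUpToIso_hom h₂ ⟨n⟩
  let e₃ := (colimit.isColimit S'.X₃).coconePointUniqueUpToIso h₃
  have w₃ (n : J) : colimit.ι S'.X₃ ⟨n⟩ ≫ e₃.hom = (j n).τ₃ :=
    colimit.comp_coconePointUniqueUpToIso_hom h₃ ⟨n⟩
  let u : S'.map colim ≅ T := ShortComplex.isoMk e₁ e₂ e₃
    (colimit.hom_ext fun ⟨n⟩ ↦ by
      change colimit.ι S'.X₁ ⟨n⟩ ≫ _ ≫ T.f = colimit.ι S'.X₁ ⟨n⟩ ≫ colim.map S'.f ≫ _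
      rw [reassoc_of% w₁ n, colimit.ι_map_assoc, w₂ n]
      exact (j n).comm₁₂)
    (colimit.hom_ext fun ⟨n⟩ ↦ by
      change colimit.ι S'.X₂ ⟨n⟩ ≫ _ ≫ T.g = colimit.ι S'.X₂ ⟨n⟩ ≫ colim.map S'.g ≫ _
      rw [reassoc_of% w₂ n, colimit.ι_map_assoc, w₃ n]
      exact (j n).comm₂₃)
  let τ (n : J) : (evaluation (Discrete J) C).obj ⟨n⟩ ⟶ colim :=
    { app := fun G ↦ colimit.ι G ⟨n⟩ }
  let j' (n : J) : S n ⟶ S'.map colim := S'.mapNatTrans (τ n)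
  have hj' (n : J) : j' n ≫ u.hom = j n := by
    ext
    · exact w₁ n
    · exact w₂ n
    · exact w₃ n
  let i : colimit S'.homology ≅ T.homology :=
    (S'.mapHomologyIso colim).symm ≪≫ ShortComplex.homologyMapIso u
  let a (n : J) : (S n).homology ≅ S'.homology.obj ⟨n⟩ :=
    S'.mapHomologyIso ((evaluation (Discrete J) C).obj ⟨n⟩)
  have ha (n : J) : (a n).hom ≫ colimit.ι S'.homology ⟨n⟩ =
      ShortComplex.homologyMap (j' n) ≫ (S'.mapHomologyIso colim).hom :=
    (Iso.eq_inv_comp _).1 (NatTrans.app_homology (τ n) S')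
  have hi (n : J) : (a n).hom ≫ colimit.ι S'.homology ⟨n⟩ ≫ i.hom =
      ShortComplex.homologyMap (j n) := by
    rw [← hj' n, ShortComplex.homologyMap_comp, reassoc_of% ha n]
    simp [i]
  exact ⟨Cofan.IsColimit.mk _
    (fun s ↦ i.inv ≫ colimit.desc S'.homology
      ⟨s.pt, Discrete.natTrans fun n ↦ (a n.as).inv ≫ s.inj n.as⟩)
    (fun s n ↦ by
      dsimp
      rw [← hi]
      simp)
    (fun s m hm ↦ by
      rw [← cancel_epi i.hom]
      refine colimit.hom_ext fun ⟨n⟩ ↦ ?_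
      rw [← cancel_epi (a n).hom]
      have := hm n
      dsimp at this
      rw [← hi] at this
      simpa using this)⟩

instance preservesColimit_discreteFunctor_homologyFunctor (F : J → CochainComplex C ℤ) (t : ℤ) :
    PreservesColimit (Discrete.functor F)
      (HomologicalComplex.homologyFunctor C (ComplexShape.up ℤ) t) := by
  have h (i : ℤ) := isColimitCofanMkObjOfIsColimit
    (HomologicalComplex.eval C (ComplexShape.up ℤ) i) F (Sigma.ι F) (coproductIsCoproduct F)
  obtain ⟨hc⟩ := nonempty_isColimit_cofan_homologyMap (fun n ↦ (F n).sc t) ((∐ F).sc t)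
    (fun n ↦ (HomologicalComplex.shortComplexFunctor C _ t).map (Sigma.ι F n)) (h _) (h _) (h _)
  exact preservesColimit_of_preserves_colimit_cocone (coproductIsCoproduct F)
    ((isColimitMapCoconeCofanMkEquiv _ F (Sigma.ι F)).symm hc)

variable [HasDerivedCategory.{w} C]

/-- The homology of the image in the derived category of a coproduct of complexes is the
coproduct of the homologies. -/
noncomputable def isColimitCofanHomologyMapQ (F : J → CochainComplex C ℤ) (t : ℤ) :
    IsColimit (Cofan.mk ((homologyFunctor C t).obj (Q.obj (∐ F)))
      fun n ↦ (homologyFunctor C t).map (Q.map (Sigma.ι F n))) :=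
  have := preservesColimit_of_natIso (Discrete.functor F) (homologyFunctorFactors C t).symm
  isColimitCofanMkObjOfIsColimit (Q ⋙ homologyFunctor C t) F (Sigma.ι F) (coproductIsCoproduct F)

theorem homologyMap_Q_sigma_hom_ext {F : J → CochainComplex C ℤ} {t : ℤ} {X : C}
    {a b : (homologyFunctor C t).obj (Q.obj (∐ F)) ⟶ X}
    (h : ∀ n, (homologyFunctor C t).map (Q.map (Sigma.ι F n)) ≫ a =
      (homologyFunctor C t).map (Q.map (Sigma.ι F n)) ≫ b) : a = b :=
  Cofan.IsColimit.hom_ext (isColimitCofanHomologyMapQ F t) _ _ h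

theorem isIso_Q_map_sigmaMap {F G : J → CochainComplex C ℤ} (s : ∀ n, F n ⟶ G n)
    [∀ n, IsIso (Q.map (s n))] : IsIso (Q.map (Limits.Sigma.map s)) := by
  rw [isIso_iff]
  intro t
  let H := homologyFunctor C t
  let r : H.obj (Q.obj (∐ G)) ⟶ H.obj (Q.obj (∐ F)) :=
    Cofan.IsColimit.desc (isColimitCofanHomologyMapQ G t)
      fun n ↦ inv (H.map (Q.map (s n))) ≫ H.map (Q.map (Sigma.ι F n))
  have hr (n : J) : H.map (Q.map (Sigma.ι G n)) ≫ r =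
      inv (H.map (Q.map (s n))) ≫ H.map (Q.map (Sigma.ι F n)) :=
    Cofan.IsColimit.fac (isColimitCofanHomologyMapQ G t) _ n
  have hs (n : J) : H.map (Q.map (Sigma.ι F n)) ≫ H.map (Q.map (Limits.Sigma.map s)) =
      H.map (Q.map (s n)) ≫ H.map (Q.map (Sigma.ι G n)) := by
    simp only [← Functor.map_comp, Sigma.ι_map]
  refine ⟨r, homologyMap_Q_sigma_hom_ext fun n ↦ ?_, homologyMap_Q_sigma_hom_ext fun n ↦ ?_⟩
  · change H.map _ ≫ H.map _ ≫ r = _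
    rw [reassoc_of% hs n, hr, IsIso.hom_inv_id_assoc, Category.comp_id]
  · change H.map _ ≫ r ≫ H.map _ = _
    rw [reassoc_of% hr n, hs, IsIso.inv_hom_id_assoc, Category.comp_id]

theorem exists_Q_sigma_desc {F : J → CochainComplex C ℤ} {Y : DerivedCategory C}
    (e : ∀ n, Q.obj (F n) ⟶ Y) :
    ∃ p : Q.obj (∐ F) ⟶ Y, ∀ n, Q.map (Sigma.ι F n) ≫ p = e n := by
  let i := Q.objObjPreimageIso Y
  choose F' s hs g hg using fun n ↦ right_fac (e n ≫ i.inv)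
  have := isIso_Q_map_sigmaMap s
  refine ⟨inv (Q.map (Limits.Sigma.map s)) ≫ Q.map (Sigma.desc g) ≫ i.hom, fun n ↦ ?_⟩
  have h : Q.map (Sigma.ι F n) ≫ inv (Q.map (Limits.Sigma.map s)) =
      inv (Q.map (s n)) ≫ Q.map (Sigma.ι F' n) := by
    rw [IsIso.comp_inv_eq, Category.assoc, ← Functor.map_comp, Sigma.ι_map, Functor.map_comp,
      IsIso.inv_hom_id_assoc]
  rw [reassoc_of% h, ← Functor.map_comp_assoc, Sigma.ι_desc, ← Category.assoc, ← hg]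
  simp

theorem Q_sigma_hom_ext {F : J → CochainComplex C ℤ} {Y : DerivedCategory C}
    {p q : Q.obj (∐ F) ⟶ Y}
    (h : ∀ n, Q.map (Sigma.ι F n) ≫ p = Q.map (Sigma.ι F n) ≫ q) : p = q := by
  obtain ⟨W, k, δ, hT⟩ := distinguished_cocone_triangle₁ (p - q)
  have hlift (n : J) : ∃ l : Q.obj (F n) ⟶ W, Q.map (Sigma.ι F n) = l ≫ k :=
    Triangle.coyoneda_exact₂ _ hT _ (by
      change _ ≫ (p - q) = 0
      rw [Preadditive.comp_sub, h n, sub_self])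
  choose l hl using hlift
  obtain ⟨m, hm⟩ := exists_Q_sigma_desc l
  -- The endomorphism `m ≫ k` restricts to the identity on each summand, so it is bijective on
  -- homology.
  have hmk : IsIso (m ≫ k) := by
    rw [isIso_iff]
    intro t
    have : (homologyFunctor C t).map (m ≫ k) = 𝟙 _ := homologyMap_Q_sigma_hom_ext fun n ↦ by
      rw [← Functor.map_comp, reassoc_of% hm n, ← hl, Category.comp_id]
    rw [this]
    infer_instance
  have hk : k ≫ (p - q) = 0 := comp_distTriang_mor_zero₁₂ _ hT
  rw [← sub_eq_zero, ← cancel_epi (m ≫ k), Category.assoc, hk, comp_zero, comp_zero]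

end Homology

section EventuallyConstant

variable {C : Type*} [Category* C]

theorem exists_comp_eq_of_eventually_isIso {X : ℕ → C} (f : ∀ n, X n ⟶ X (n + 1)) {Z : C}
    (q : ∀ n, X n ⟶ Z) (hq : ∀ n, f n ≫ q (n + 1) = q n) (K : ℕ) [IsIso (q K)] {T : C}
    (d : ∀ n, X n ⟶ T) (hd : ∀ n, f n ≫ d (n + 1) = d n) (hK : ∀ n ≥ K, IsIso (f n)) :
    ∃ a : Z ⟶ T, ∀ n, q n ≫ a = d n := by
  refine ⟨inv (q K) ≫ d K, fun n ↦ ?_⟩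
  obtain hn | hn := le_total K n
  · induction n, hn using Nat.le_induction with
    | base => simp
    | succ n hn ih =>
      have := hK n hn
      rw [← cancel_epi (f n), reassoc_of% hq n, ih, hd]
  · induction hn using Nat.decreasingInduction with
    | self => simp
    | of_succ n hn ih => rw [← hq n, Category.assoc, ih, hd]

variable [Preadditive C]

theorem exists_sub_comp_succ_eq {X : ℕ → C} (f : ∀ n, X n ⟶ X (n + 1)) (K : ℕ)
    (hf : ∀ n ≥ K, IsIso (f n)) {T : C} (c : ∀ n, X n ⟶ T) :
    ∃ r : ∀ n, X n ⟶ T, ∀ n, r n - f n ≫ r (n + 1) = c n := by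
  induction K generalizing X with
  | zero =>
    have hf (n : ℕ) : IsIso (f n) := hf n n.zero_le
    exact ⟨fun n ↦ Nat.rec 0 (fun n a ↦ inv (f n) ≫ (a - c n)) n, fun n ↦ by simp⟩
  | succ K ih =>
    obtain ⟨r, hr⟩ := ih (fun n ↦ f (n + 1)) (fun n hn ↦ hf _ (by lia)) (fun n ↦ c (n + 1))
    refine ⟨fun n ↦ Nat.casesOn n (c 0 + f 0 ≫ r 0) r, fun n ↦ ?_⟩
    cases n with
    | zero => simp
    | succ n => exact hr n

/-- For a sequence `X` with coproduct `T` which is eventually isomorphic to `Z`, the sequence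
`0 ⟶ T ⟶ T ⟶ Z ⟶ 0` with first map `id - shift` is split. -/
theorem exists_splitting_of_eventually_isIso {X : ℕ → C} (f : ∀ n, X n ⟶ X (n + 1)) {Z : C}
    (q : ∀ n, X n ⟶ Z) (hq : ∀ n, f n ≫ q (n + 1) = q n) (K : ℕ) (hK : ∀ n ≥ K, IsIso (q n))
    {T : C} (i : ∀ n, X n ⟶ T) (hT : IsColimit (Cofan.mk T i)) (σ : T ⟶ T)
    (hσ : ∀ n, i n ≫ σ = f n ≫ i (n + 1)) (p : T ⟶ Z) (hp : ∀ n, i n ≫ p = q n) :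
    ∃ (r : T ⟶ T) (a : Z ⟶ T), (𝟙 T - σ) ≫ r = 𝟙 T ∧ r ≫ (𝟙 T - σ) = 𝟙 T + p ≫ a := by
  have hf (n : ℕ) (hn : n ≥ K) : IsIso (f n) := by
    have := hK n hn
    have := hK (n + 1) (by lia)
    have : IsIso (f n ≫ q (n + 1)) := by rwa [hq]
    exact IsIso.of_isIso_comp_right (f n) (q (n + 1))
  have := hK K le_rfl
  obtain ⟨r', hr'⟩ := exists_sub_comp_succ_eq f K hf i
  let r : T ⟶ T := Cofan.IsColimit.desc hT r'
  have hr (n : ℕ) : i n ≫ r = r' n := Cofan.IsColimit.fac hT r' n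
  obtain ⟨a, ha⟩ := exists_comp_eq_of_eventually_isIso f q hq K
    (fun n ↦ r' n ≫ (𝟙 T - σ) - i n) (fun n ↦ by
      have h : f n ≫ r' (n + 1) = r' n - i n := by rw [← hr' n]; abel
      rw [Preadditive.comp_sub, reassoc_of% h, ← hσ]
      simp only [Preadditive.comp_sub, Preadditive.sub_comp, Category.comp_id]
      abel) hf
  refine ⟨r, a, Cofan.IsColimit.hom_ext hT _ _ fun n ↦ ?_,
    Cofan.IsColimit.hom_ext hT _ _ fun n ↦ ?_⟩
  · change i n ≫ _ = i n ≫ _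
    rw [Preadditive.sub_comp, Preadditive.comp_sub, reassoc_of% hσ n, Category.id_comp, hr, hr,
      hr', Category.comp_id]
  · change i n ≫ _ = i n ≫ _
    rw [reassoc_of% hr n, Preadditive.comp_add, reassoc_of% hp n, ha, Category.comp_id]
    abel

end EventuallyConstant

theorem hocolim_of_approximation
    (F : ℕ → CochainComplex A ℤ)
    (f : ∀ n, (Q.obj (F n) : DerivedCategory A) ⟶ Q.obj (F (n + 1)))
    (Y : DerivedCategory A) (e : ∀ n, Q.obj (F n) ⟶ Y)
    (he : ∀ n, f n ≫ e (n + 1) = e n)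
    (happrox : Approximates F Y e)
    (L : DerivedCategory A) (hL : IsHocolimQ F f L) :
    Nonempty (L ≅ Y) := by
  have : CountableAB4 A := countableAB4_of_exact_sequential_colimits
  obtain ⟨σ, hσ, g, h, hT⟩ := hL
  obtain ⟨p, hp⟩ := exists_Q_sigma_desc e
  have hp0 : (𝟙 (Q.obj (∐ F)) - σ) ≫ p = 0 := Q_sigma_hom_ext fun n ↦ by
    rw [Preadditive.sub_comp, Preadditive.comp_sub, reassoc_of% hσ n, Category.id_comp, hp, hp,
      he, sub_self, comp_zero]
  obtain ⟨φ, rfl⟩ : ∃ φ : L ⟶ Y, p = g ≫ φ := Triangle.yoneda_exact₂ _ hT p hp0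
  have hK (t : ℤ) : ∃ K : ℕ, ∀ k ≥ K, IsIso ((homologyFunctor A t).map (e k)) := by
    obtain ⟨K, hK⟩ := happrox t.natAbs
    exact ⟨K, fun k hk ↦ hK k hk t (by lia) (by lia)⟩
  have hsplit (t : ℤ) : ∃ r a, (homologyFunctor A t).map (𝟙 _ - σ) ≫ r = 𝟙 _ ∧
      r ≫ (homologyFunctor A t).map (𝟙 _ - σ) =
        𝟙 _ + (homologyFunctor A t).map (g ≫ φ) ≫ a := by
    let H := homologyFunctor A t
    obtain ⟨K, hK⟩ := hK t
    rw [Functor.map_sub, CategoryTheory.Functor.map_id]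
    exact exists_splitting_of_eventually_isIso (fun n ↦ H.map (f n)) (fun n ↦ H.map (e n))
      (fun n ↦ by rw [← H.map_comp, he]) K hK
      (fun n ↦ H.map (Q.map (Sigma.ι F n))) (isColimitCofanHomologyMapQ F t) (H.map σ)
      (fun n ↦ by rw [← H.map_comp, hσ, H.map_comp]) (H.map (g ≫ φ))
      (fun n ↦ by rw [← H.map_comp, hp])
  suffices IsIso φ from ⟨asIso φ⟩
  rw [isIso_iff]
  intro t
  let H := homologyFunctor A t
  have hg : Epi (H.map g) := by
    obtain ⟨r, -, hr, -⟩ := hsplit (t + 1)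
    have : Mono ((homologyFunctor A (t + 1)).map (𝟙 (Q.obj (∐ F)) - σ)) :=
      (SplitMono.mk r hr).mono
    exact (HomologySequence.epi_homologyMap_mor₂_iff _ hT t (t + 1)).2
      ((HomologySequence.mono_homologyMap_mor₁_iff _ hT t (t + 1)).1 this)
  have hepi : Epi (H.map φ) := by
    obtain ⟨K, hK⟩ := hK t
    have := hK K le_rfl
    refine epi_of_epi_fac (f := H.map (Q.map (Sigma.ι F K) ≫ g)) (h := H.map (e K)) ?_
    rw [← H.map_comp, Category.assoc, hp]
  have hmono : Mono (H.map φ) := by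
    obtain ⟨r, a, -, hr⟩ := hsplit t
    have hσg : H.map (𝟙 (Q.obj (∐ F)) - σ) ≫ H.map g = 0 := by
      rw [← H.map_comp]
      exact (congrArg H.map (comp_distTriang_mor_zero₁₂ _ hT)).trans (H.map_zero _ _)
    have h₀ : H.map g + H.map g ≫ H.map φ ≫ a ≫ H.map g = 0 := by
      simpa [H, hσg, -Functor.map_sub] using (congrArg (· ≫ H.map g) hr).symm
    refine (SplitMono.mk (-(a ≫ H.map g)) ?_).mono
    rw [← cancel_epi (H.map g), Preadditive.comp_neg, Preadditive.comp_neg, Category.comp_id,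
      neg_eq_iff_add_eq_zero, add_comm]
    exact h₀
  exact isIso_of_mono_of_epi _
end

section
/- Let A be an abelian category with countable coproducts in which colimits of sequences exist and are exact, and let B be a full subcategory of A closed under isomorphisms. Let D^-_B(A) denote the full subcategory of the unbounded derived category D(A) consisting of objects whose cohomology is bounded above and all of whose cohomology objects lie in B. If F_1 → F_2 → F_3 → … is a sequence in D^-_B(A) which stabilizes in finite degrees, i.e. for every integer n there exists I such that the induced morphism τ^{≥n}F_i → τ^{≥n}F_{i+1} is an isomorphism for all i ≥ I, then hocolim F_i ∈ D^-_B(A). -/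
/-!
STATEMENT 13:
Let `A` be an abelian category with countable coproducts in which colimits of sequences exist
and are exact, and let `B` be a full subcategory of `A` closed under isomorphisms. Let
`D^-_B(A)` denote the full subcategory of `D(A)` consisting of objects whose cohomology is
bounded above and all of whose cohomology objects lie in `B`. If `F₁ → F₂ → …` is a sequence
in `D^-_B(A)` which stabilizes in finite degrees (for every `n` the morphism
`τ^{≥n}Fᵢ → τ^{≥n}Fᵢ₊₁` is an isomorphism, equivalently `H^t(Fᵢ) → H^t(Fᵢ₊₁)` is an
isomorphism for all `t ≥ n`, for `i` large), then `hocolim Fᵢ ∈ D^-_B(A)`.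
-/

open CategoryTheory CategoryTheory.Limits CategoryTheory.Pretriangulated ZeroObject
  DerivedCategory

universe w v u

variable {A : Type u} [Category.{v} A] [Abelian A]
  [HasCountableCoproducts A] [HasColimitsOfShape ℕ A]
  [PreservesFiniteLimits (colim : (ℕ ⥤ A) ⥤ A)]
  [HasDerivedCategory.{w} A]

/-- Membership in `D^-_B(A)`: the cohomology of `G` is bounded above and all cohomology
objects of `G` lie in `B`. -/
def MemDminusB (B : Set A) (G : DerivedCategory A) : Prop :=
  (∃ N : ℤ, ∀ n : ℤ, N ≤ n → IsZero ((homologyFunctor A n).obj G)) ∧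
  ∀ n : ℤ, (homologyFunctor A n).obj G ∈ B

/-- The sequence `(F, f)` stabilizes in finite degrees: for every `n` the induced morphism
`τ^{≥n}Fᵢ → τ^{≥n}Fᵢ₊₁` is an isomorphism for `i` large, equivalently all the maps
`H^t(Fᵢ) → H^t(Fᵢ₊₁)` with `t ≥ n` are isomorphisms for `i` large. -/
def StabilizesInFiniteDegrees (F : ℕ → CochainComplex A ℤ)
    (f : ∀ n, (Q.obj (F n) : DerivedCategory A) ⟶ Q.obj (F (n + 1))) : Prop :=
  ∀ n : ℤ, ∃ I : ℕ, ∀ i ≥ I, ∀ t : ℤ, n ≤ t → IsIso ((homologyFunctor A t).map (f i))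

section HomologyPreservesColimits

variable {C : Type*} [Category* C] [Abelian C] {J : Type*} [Category* J]

/-- The homology functor on short complexes preserves colimits of shape `J` if these are exact. -/
theorem CategoryTheory.ShortComplex.preservesColimitsOfShape_homologyFunctor
    [HasColimitsOfShape J C] [HasExactColimitsOfShape J C] :
    PreservesColimitsOfShape J (ShortComplex.homologyFunctor C) where
  preservesColimit {G} := by
    let S := (ShortComplex.functorEquivalence J C).inverse.obj G
    let τ (j : J) : (evaluation J C).obj j ⟶ colim := { app := fun K => colimit.ι K j }
    have : (colim : (J ⥤ C) ⥤ C).PreservesHomology := inferInstance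
    let c : Cocone G :=
      { pt := S.map colim
        ι :=
          { app := fun j => S.mapNatTrans (τ j)
            naturality := fun j k f => by
              ext
              · exact (colimit.w S.X₁ f).trans (Category.comp_id _).symm
              · exact (colimit.w S.X₂ f).trans (Category.comp_id _).symm
              · exact (colimit.w S.X₃ f).trans (Category.comp_id _).symm } }
    have hc : IsColimit c := ShortComplex.isColimitOfIsColimitπ c
      (IsColimit.ofIsoColimit (colimit.isColimit S.X₁)
        (Cocone.ext (Iso.refl _) fun _ => Category.comp_id _))
      (IsColimit.ofIsoColimit (colimit.isColimit S.X₂)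
        (Cocone.ext (Iso.refl _) fun _ => Category.comp_id _))
      (IsColimit.ofIsoColimit (colimit.isColimit S.X₃)
        (Cocone.ext (Iso.refl _) fun _ => Category.comp_id _))
    refine preservesColimit_of_preserves_colimit_cocone hc ?_
    let e : G ⋙ ShortComplex.homologyFunctor C ≅ S.homology :=
      NatIso.ofComponents (fun j => S.mapHomologyIso ((evaluation J C).obj j)) (fun {j k} f => by
        have h := NatTrans.app_homology ((evaluation J C).map f) S
        exact ((Iso.eq_inv_comp _).1 h).symm)
    refine IsColimit.ofIsoColimit
      ((IsColimit.precomposeHomEquiv e _).symm (colimit.isColimit S.homology))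
      (Cocone.ext (S.mapHomologyIso colim).symm (fun j => ?_))
    have h := NatTrans.app_homology (τ j) S
    have h' : (S.mapHomologyIso ((evaluation J C).obj j)).hom ≫ (τ j).app S.homology ≫
        (S.mapHomologyIso colim).inv = ShortComplex.homologyMap (S.mapNatTrans (τ j)) := by
      simp [h]
    exact (Category.assoc _ _ _).trans h'

theorem HomologicalComplex.preservesColimitsOfShape_homologyFunctor [HasColimitsOfShape J C]
    [HasExactColimitsOfShape J C] {ι : Type*} (c : ComplexShape ι) (i : ι) :
    PreservesColimitsOfShape J (HomologicalComplex.homologyFunctor C c i) := by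
  have := ShortComplex.preservesColimitsOfShape_homologyFunctor (C := C) (J := J)
  have : PreservesColimitsOfShape J (HomologicalComplex.shortComplexFunctor C c i) :=
    ⟨⟨fun {s} hs => ⟨ShortComplex.isColimitOfIsColimitπ _
      (isColimitOfPreserves (HomologicalComplex.eval C c (c.prev i)) hs)
      (isColimitOfPreserves (HomologicalComplex.eval C c i) hs)
      (isColimitOfPreserves (HomologicalComplex.eval C c (c.next i)) hs)⟩⟩⟩
  exact preservesColimitsOfShape_of_natIso (HomologicalComplex.homologyFunctorIso C c i).symm

end HomologyPreservesColimits

section Telescope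

variable {C : Type*} [Category* C] [Preadditive C]

/-- The recursion `z n = c n + a n ≫ z (n + 1)` with prescribed value at `I` is solvable if the
`a i` are isomorphisms for `i ≥ I`. -/
theorem exists_telescope_solution {Z : C} (I : ℕ) :
    ∀ {X : ℕ → C} (a : ∀ n, X n ⟶ X (n + 1)) (_ : ∀ i ≥ I, IsIso (a i))
      (y : X I ⟶ Z) (c : ∀ n, X n ⟶ Z),
      ∃ z : ∀ n, X n ⟶ Z, z I = y ∧ ∀ n, z n = c n + a n ≫ z (n + 1) := by
  induction I with
  | zero =>
    intro X a ha y c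
    have := fun n => ha n (Nat.zero_le n)
    exact ⟨fun n => Nat.rec y (fun n z => inv (a n) ≫ (z - c n)) n, rfl, fun n => by simp⟩
  | succ I ih =>
    intro X a ha y c
    obtain ⟨z, hz, hz'⟩ := ih (X := fun n => X (n + 1)) (fun n => a (n + 1))
      (fun i hi => ha (i + 1) (by lia)) y (fun n => c (n + 1))
    refine ⟨fun n => Nat.casesOn n (c 0 + a 0 ≫ z 0) z, hz, fun n => ?_⟩
    cases n with
    | zero => rfl
    | succ n => exact hz' n

theorem telescope_eq_zero {Z : C} {X : ℕ → C} (a : ∀ n, X n ⟶ X (n + 1)) (I : ℕ)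
    (ha : ∀ i ≥ I, IsIso (a i)) (d : ∀ n, X n ⟶ Z) (hI : d I = 0)
    (hd : ∀ n, d n = a n ≫ d (n + 1)) (n : ℕ) : d n = 0 := by
  obtain h | h := le_total n I
  · induction h using Nat.decreasingInduction with
    | self => exact hI
    | of_succ k _ hk => rw [hd, hk, comp_zero]
  · induction n, h using Nat.le_induction with
    | base => exact hI
    | succ k hk h =>
      have := ha k hk
      rw [← cancel_epi (a k), ← hd, h, comp_zero]

/-- For a sequence whose transition maps are isomorphisms from the index `I` on, `𝟙 - shift`
on the coproduct is a split monomorphism whose cokernel is the `I`-th term. -/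
theorem exists_telescope_splitting {X : ℕ → C} (a : ∀ n, X n ⟶ X (n + 1)) (I : ℕ)
    (ha : ∀ i ≥ I, IsIso (a i)) {P : C} {ι : ∀ n, X n ⟶ P} (hP : IsColimit (Cofan.mk P ι))
    (σ : P ⟶ P) (hσ : ∀ n, ι n ≫ σ = a n ≫ ι (n + 1)) :
    ∃ (p : P ⟶ X I) (r : P ⟶ P), ι I ≫ p = 𝟙 _ ∧ (𝟙 P - σ) ≫ p = 0 ∧
      (𝟙 P - σ) ≫ r = 𝟙 P ∧ r ≫ (𝟙 P - σ) + p ≫ ι I = 𝟙 P := by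
  obtain ⟨p, hpI, hp⟩ := exists_telescope_solution I a ha (𝟙 (X I)) 0
  obtain ⟨r, hrI, hr⟩ := exists_telescope_solution I a ha (0 : X I ⟶ P) ι
  have exists_desc {Z : C} (f : ∀ n, X n ⟶ Z) : ∃ g : P ⟶ Z, ∀ n, ι n ≫ g = f n :=
    ⟨Cofan.IsColimit.desc hP f, Cofan.IsColimit.fac hP f⟩
  have hom_ext {Z : C} {f g : P ⟶ Z} (h : ∀ n, ι n ≫ f = ι n ≫ g) : f = g :=
    Cofan.IsColimit.hom_ext hP _ _ h
  obtain ⟨p', hp'⟩ := exists_desc p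
  obtain ⟨r', hr'⟩ := exists_desc r
  simp only [Pi.zero_apply, zero_add] at hp
  refine ⟨p', r', ?_, ?_, ?_, ?_⟩
  · rw [hp', hpI]
  · refine hom_ext fun n => ?_
    simp [reassoc_of% hσ, hp', ← hp]
  · refine hom_ext fun n => ?_
    simp [reassoc_of% hσ, hr', sub_eq_iff_eq_add, ← hr]
  · refine hom_ext fun n => sub_eq_zero.1 ?_
    refine telescope_eq_zero a I ha
      (fun n => ι n ≫ (r' ≫ (𝟙 P - σ) + p' ≫ ι I) - ι n ≫ 𝟙 P) ?_ (fun n => ?_) n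
    · simp [reassoc_of% hp', hr', reassoc_of% hr', hpI, hrI]
    · simp only [Preadditive.comp_add, Preadditive.comp_sub, Category.comp_id, reassoc_of% hp', hr',
        reassoc_of% hr']
      rw [hr n, hp n]
      simp only [Preadditive.add_comp, Category.assoc, hσ]
      abel

end Telescope

section Hocolim

variable (F : ℕ → CochainComplex A ℤ)

/-- The cohomology of a countable coproduct of complexes is the coproduct of the cohomologies. -/
noncomputable def isColimitCofanHomologySigma (n : ℤ) :
    IsColimit (Cofan.mk ((homologyFunctor A n).obj (Q.obj (∐ F)))
      (fun i => (homologyFunctor A n).map (Q.map (Sigma.ι F i)))) := by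
  have : HasExactColimitsOfShape ℕ A := ⟨inferInstance⟩
  have : HasFiniteBiproducts A := Abelian.hasFiniteBiproducts
  have := CountableAB4.of_countableAB5 A
  have := HomologicalComplex.preservesColimitsOfShape_homologyFunctor (C := A)
    (J := Discrete ℕ) (ComplexShape.up ℤ) n
  have : PreservesColimitsOfShape (Discrete ℕ) (Q ⋙ homologyFunctor A n) :=
    preservesColimitsOfShape_of_natIso (homologyFunctorFactors A n).symm
  exact isColimitCofanMkObjOfIsColimit (Q ⋙ homologyFunctor A n) F _ (coproductIsCoproduct F)

variable {F} {f : ∀ n, (Q.obj (F n) : DerivedCategory A) ⟶ Q.obj (F (n + 1))}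
  {L : DerivedCategory A}

/-- If the transition maps are isomorphisms in cohomological degrees `t` and `t + 1` from the
index `I` on, then the `t`-th cohomology of the homotopy colimit is that of the `I`-th term. -/
theorem IsHocolimQ.nonempty_homology_iso (hL : IsHocolimQ F f L) (t : ℤ) (I : ℕ)
    (h₀ : ∀ i ≥ I, IsIso ((homologyFunctor A t).map (f i)))
    (h₁ : ∀ i ≥ I, IsIso ((homologyFunctor A (t + 1)).map (f i))) :
    Nonempty ((homologyFunctor A t).obj (Q.obj (F I)) ≅ (homologyFunctor A t).obj L) := by
  obtain ⟨σ, hσ, g, h, hT⟩ := hL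
  have hσ' (s : ℤ) (n : ℕ) : (homologyFunctor A s).map (Q.map (Sigma.ι F n)) ≫
      (homologyFunctor A s).map σ = (homologyFunctor A s).map (f n) ≫
        (homologyFunctor A s).map (Q.map (Sigma.ι F (n + 1))) := by
    simp only [← Functor.map_comp, hσ]
  have hsub (s : ℤ) : (homologyFunctor A s).map (𝟙 (Q.obj (∐ F)) - σ) =
      𝟙 _ - (homologyFunctor A s).map σ := by
    rw [CategoryTheory.Functor.map_sub, CategoryTheory.Functor.map_id]
  obtain ⟨p, r, hp, hσp, -, hrp⟩ := exists_telescope_splitting _ I h₀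
    (isColimitCofanHomologySigma F t) _ (hσ' t)
  obtain ⟨-, r₁, -, -, hr₁, -⟩ := exists_telescope_splitting _ I h₁
    (isColimitCofanHomologySigma F (t + 1)) _ (hσ' (t + 1))
  rw [← hsub] at hσp hrp hr₁
  have hg : (homologyFunctor A t).map (𝟙 (Q.obj (∐ F)) - σ) ≫ (homologyFunctor A t).map g = 0 := by
    rw [← Functor.map_comp]
    exact (congrArg _ (comp_distTriang_mor_zero₁₂ _ hT)).trans (Functor.map_zero _ _ _)
  have hmono : Mono ((homologyFunctor A (t + 1)).map (𝟙 (Q.obj (∐ F)) - σ)) :=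
    mono_of_mono_fac hr₁
  have hepi : Epi ((homologyFunctor A t).map g) :=
    (HomologySequence.epi_homologyMap_mor₂_iff _ hT t (t + 1) rfl).2
      ((HomologySequence.mono_homologyMap_mor₁_iff _ hT t (t + 1) rfl).1 hmono)
  have hex : (ShortComplex.mk _ _ hg).Exact := HomologySequence.exact₂ _ hT t
  have : Epi (ShortComplex.mk _ _ hg).g := hepi
  obtain ⟨q, hq⟩ := hex.desc' p hσp
  dsimp only at hq
  refine ⟨⟨(homologyFunctor A t).map (Q.map (Sigma.ι F I)) ≫ (homologyFunctor A t).map g, q,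
    ?_, ?_⟩⟩
  · rw [Category.assoc, hq, hp]
  · rw [← cancel_epi ((homologyFunctor A t).map g), reassoc_of% hq, Category.comp_id]
    have := congrArg (· ≫ (homologyFunctor A t).map g) hrp
    simpa only [Preadditive.add_comp, Category.assoc, hg, comp_zero, zero_add,
      Category.id_comp] using this

end Hocolim

theorem hocolim_mem_DminusB
    (B : Set A) (hB : ∀ {X Y : A}, (X ≅ Y) → X ∈ B → Y ∈ B)
    (F : ℕ → CochainComplex A ℤ)
    (f : ∀ n, (Q.obj (F n) : DerivedCategory A) ⟶ Q.obj (F (n + 1)))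
    (hmem : ∀ n, MemDminusB B (Q.obj (F n)))
    (hstab : StabilizesInFiniteDegrees F f)
    (L : DerivedCategory A) (hL : IsHocolimQ F f L) :
    MemDminusB B L := by
  have key (n : ℤ) : ∃ I : ℕ, ∀ t : ℤ, n ≤ t →
      Nonempty ((homologyFunctor A t).obj (Q.obj (F I)) ≅ (homologyFunctor A t).obj L) := by
    obtain ⟨I, hI⟩ := hstab n
    exact ⟨I, fun t ht => hL.nonempty_homology_iso t I (fun i hi => hI i hi t ht)
      (fun i hi => hI i hi (t + 1) (by lia))⟩
  refine ⟨?_, fun n => ?_⟩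
  · obtain ⟨I, hI⟩ := key 0
    obtain ⟨N, hN⟩ := (hmem I).1
    refine ⟨max 0 N, fun t ht => ?_⟩
    obtain ⟨e⟩ := hI t (le_of_max_le_left ht)
    exact (hN t (le_of_max_le_right ht)).of_iso e.symm
  · obtain ⟨I, hI⟩ := key n
    obtain ⟨e⟩ := hI n le_rfl
    exact hB e ((hmem I).2 n)
end

section
/- Let T be a triangulated category admitting arbitrary (small) coproducts, and let E1 and E2 be two classes of compact objects of T which are semiorthogonal, i.e. Hom(B[k], A) = 0 for all A ∈ E1, B ∈ E2 and all integers k. Let Ê1 (resp. Ê2) be the smallest strictly full triangulated subcategory of T containing E1 (resp. E2) and closed under arbitrary coproducts. Then Ê1 and Ê2 are semiorthogonal: Hom(B'[k], A') = 0 for all A' ∈ Ê1, B' ∈ Ê2 and all integers k. -/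
/-!
STATEMENT 15:
Let `T` be a triangulated category admitting arbitrary (small) coproducts, and let `E1`, `E2`
be two classes of compact objects of `T` which are semiorthogonal. Let `Ê1` (resp. `Ê2`) be
the smallest strictly full triangulated subcategory of `T` containing `E1` (resp. `E2`) and
closed under arbitrary coproducts. Then `Ê1` and `Ê2` are semiorthogonal:
`Hom(B'[k], A') = 0` for all `A' ∈ Ê1`, `B' ∈ Ê2` and all integers `k`.

An object `P` is compact if the canonical map `⊕_α Hom(P, F_α) → Hom(P, ⊕_α F_α)` is an
isomorphism (of abelian groups) for every small family `(F_α)`.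
-/

open CategoryTheory CategoryTheory.Limits CategoryTheory.Pretriangulated ZeroObject

universe v u

variable {C : Type u} [Category.{v} C] [Preadditive C] [HasZeroObject C]
  [HasShift C ℤ] [∀ n : ℤ, (shiftFunctor C n).Additive] [Pretriangulated C]
  [HasCoproducts.{v} C]

/-- An object `P` is compact if for every small family `(F_α)` the canonical morphism
`⊕_α Hom(P, F_α) → Hom(P, ⊕_α F_α)` is an isomorphism. -/
def IsCompactObj (P : C) : Prop :=
  ∀ (ι : Type v) [DecidableEq ι] (F : ι → C),
    Function.Bijective
      (DirectSum.toAddMonoid (fun α : ι =>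
        AddMonoidHom.mk' (fun g : P ⟶ F α => g ≫ Sigma.ι F α)
          (fun _ _ => Preadditive.add_comp _ _ _ _ _ _)) :
        DirectSum ι (fun α => P ⟶ F α) → (P ⟶ ∐ F))

/-- A strictly full triangulated subcategory closed under arbitrary (small) coproducts. -/
structure IsCoprodClosedTriangulatedSub (S : Set C) : Prop where
  zero_mem : (0 : C) ∈ S
  iso_closed : ∀ {X Y : C}, (X ≅ Y) → X ∈ S → Y ∈ S
  shift_mem : ∀ X ∈ S, ∀ n : ℤ, X⟦n⟧ ∈ S
  ext₂ : ∀ (T : Triangle C), (T ∈ distTriang C) → T.obj₁ ∈ S → T.obj₃ ∈ S → T.obj₂ ∈ S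
  coprod_mem : ∀ (ι : Type v) (F : ι → C), (∀ α, F α ∈ S) → (∐ F) ∈ S

/-- The smallest strictly full triangulated subcategory containing `E` and closed under
arbitrary coproducts. -/
def coprodHull (E : Set C) : Set C :=
  {X | ∀ S : Set C, IsCoprodClosedTriangulatedSub S → E ⊆ S → X ∈ S}

/-- Semiorthogonality of two classes of objects: `Hom(B⟦k⟧, A) = 0` for all `A ∈ E1`,
`B ∈ E2`, `k ∈ ℤ`. -/
def Semiorthogonal (E1 E2 : Set C) : Prop :=
  ∀ A ∈ E1, ∀ B ∈ E2, ∀ k : ℤ, ∀ f : B⟦k⟧ ⟶ A, f = 0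

lemma shift_hom_eq_zero {D : Type u} [Category.{v} D] [Preadditive D] [HasShift D ℤ]
    {A B : D} (k : ℤ) (h : ∀ g : B ⟶ A⟦-k⟧, g = 0) (f : B⟦k⟧ ⟶ A) :
    f = 0 := by
  let adj := (shiftEquiv D k).toAdjunction
  have hf : adj.homEquiv B A f = adj.homEquiv B A 0 := (h _).trans (h _).symm
  exact (adj.homEquiv B A).injective hf

lemma hom_shift_eq_zero {D : Type u} [Category.{v} D] [Preadditive D] [HasShift D ℤ]
    {A B : D} (k : ℤ) (h : ∀ g : B⟦-k⟧ ⟶ A, g = 0) (f : B ⟶ A⟦k⟧) :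
    f = 0 := by
  let adj := (shiftEquiv D k).symm.toAdjunction
  have hf : (adj.homEquiv B A).symm f = (adj.homEquiv B A).symm 0 := (h _).trans (h _).symm
  exact (adj.homEquiv B A).symm.injective hf

/-- A morphism from a compact object to a coproduct vanishes if every morphism to a summand does. -/
lemma IsCompactObj.hom_sigma_eq_zero {D : Type u} [Category.{v} D] [Preadditive D]
    [HasCoproducts.{v} D] {P : D} (hP : IsCompactObj P) {ι : Type v} (F : ι → D)
    (h : ∀ α, ∀ g : P ⟶ F α, g = 0) (f : P ⟶ ∐ F) : f = 0 := by
  classical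
  obtain ⟨x, rfl⟩ := (hP ι F).2 f
  obtain rfl : x = 0 := DFinsupp.ext fun α => h α _
  exact map_zero _

lemma isCoprodClosedTriangulatedSub_coprodHull {E : Set C} :
    IsCoprodClosedTriangulatedSub (coprodHull E) where
  zero_mem := fun _ hS _ => hS.zero_mem
  iso_closed := fun e hX S hS hE => hS.iso_closed e (hX S hS hE)
  shift_mem := fun X hX n S hS hE => hS.shift_mem X (hX S hS hE) n
  ext₂ := fun T hT h₁ h₃ S hS hE => hS.ext₂ T hT (h₁ S hS hE) (h₃ S hS hE)
  coprod_mem := fun ι F hF S hS hE => hS.coprod_mem ι F fun α => hF α S hS hE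

lemma isCoprodClosedTriangulatedSub_shiftRightOrthogonal {E : Set C}
    (hE : ∀ X ∈ E, IsCompactObj X) :
    IsCoprodClosedTriangulatedSub
      {A : C | ∀ B ∈ E, ∀ k : ℤ, ∀ f : B ⟶ A⟦k⟧, f = 0} where
  zero_mem := fun B _ k f =>
    ((shiftFunctor C k).map_isZero (isZero_zero C)).eq_of_tgt f 0
  iso_closed := fun {X Y} e hX B hB k f => by
    rw [← cancel_mono ((shiftFunctor C k).map e.inv), zero_comp]
    exact hX B hB k _
  shift_mem := fun X hX n B hB k f => by
    rw [← cancel_mono ((shiftFunctorAdd C n k).inv.app X), zero_comp]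
    exact hX B hB (n + k) _
  ext₂ := fun T hT h₁ h₃ B hB k f => by
    obtain ⟨g, rfl⟩ := Triangle.coyoneda_exact₂ _ (Triangle.shift_distinguished T hT k) f
      (h₃ B hB k _)
    rw [show g = 0 from h₁ B hB k g]
    exact zero_comp
  coprod_mem := fun ι F hF B hB k f => by
    rw [← cancel_mono (PreservesCoproduct.iso (shiftFunctor C k) F).hom, zero_comp]
    exact (hE B hB).hom_sigma_eq_zero _ (fun α g => hF α B hB k g) _

lemma isCoprodClosedTriangulatedSub_leftOrthogonal {S : Set C}
    (hS : IsCoprodClosedTriangulatedSub S) :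
    IsCoprodClosedTriangulatedSub {B : C | ∀ A ∈ S, ∀ f : B ⟶ A, f = 0} where
  zero_mem := fun A _ f => (isZero_zero C).eq_of_src f 0
  iso_closed := fun {X Y} e hX A hA f => by
    rw [← cancel_epi e.hom, comp_zero]
    exact hX A hA _
  shift_mem := fun X hX n A hA f =>
    shift_hom_eq_zero n (hX _ (hS.shift_mem A hA (-n))) f
  ext₂ := fun T hT h₁ h₃ A hA f => by
    obtain ⟨g, rfl⟩ := Triangle.yoneda_exact₂ T hT f (h₁ A hA _)
    rw [h₃ A hA g, comp_zero]
  coprod_mem := fun ι F hF A hA f =>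
    Sigma.hom_ext _ _ fun α => (hF α A hA _).trans (hF α A hA _).symm

theorem semiorthogonal_coprodHull (E1 E2 : Set C)
    (hE1 : ∀ X ∈ E1, IsCompactObj X) (hE2 : ∀ X ∈ E2, IsCompactObj X)
    (h : Semiorthogonal E1 E2) :
    Semiorthogonal (coprodHull E1) (coprodHull E2) := by
  intro A hA B hB k f
  exact isCoprodClosedTriangulatedSub_leftOrthogonal isCoprodClosedTriangulatedSub_coprodHull
    |>.shift_mem B (hB _ (isCoprodClosedTriangulatedSub_leftOrthogonal
      isCoprodClosedTriangulatedSub_coprodHull) fun B hB A hA f => by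
        have hA' := hA _ (isCoprodClosedTriangulatedSub_shiftRightOrthogonal hE2)
          fun A hA B hB k g => hom_shift_eq_zero k (h A hA B hB (-k)) g
        rw [← cancel_mono ((shiftFunctorZero C ℤ).inv.app A), zero_comp]
        exact hA' B hB 0 _) k A hA f
end
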